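/- The normal subgroup N has finite index in G, and its index is at most 16. -/

import Mathlib

/-- The tree automorphism `a` as a function: flips the first letter. -/
def aFun : List Bool → List Bool
  | [] => []
  | x :: w => (!x) :: w

mutual
  /-- The tree automorphism `b` as a function. -/
  def bFun : List Bool → List Bool
    | [] => []
    | false :: w => false :: aFun w
    | true :: w => true :: cFun w
  /-- The tree automorphism `c` as a function. -/
  def cFun : List Bool → List Bool
    | [] => []
    | false :: w => false :: bFun w
    | true :: w => true :: w
end

theorem aFun_involutive : Function.Involutive aFun := by
  intro w
  cases w with
  | nil => rfl
  | cons x t => cases x <;> rfl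

theorem bcFun_involutive : ∀ w, bFun (bFun w) = w ∧ cFun (cFun w) = w := by
  intro w
  induction w with
  | nil => exact ⟨rfl, rfl⟩
  | cons x t ih =>
    cases x
    · exact ⟨by simp [bFun, aFun_involutive t], by simp [cFun, ih.1]⟩
    · exact ⟨by simp [bFun, ih.2], by simp [cFun]⟩

/-- The tree automorphism `a` of the binary rooted tree `{0,1}*`. -/
def treeA : Equiv.Perm (List Bool) := Function.Involutive.toPerm aFun aFun_involutive

/-- The tree automorphism `b` of the binary rooted tree `{0,1}*`. -/
def treeB : Equiv.Perm (List Bool) :=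
  Function.Involutive.toPerm bFun (fun w => (bcFun_involutive w).1)

/-- The tree automorphism `c` of the binary rooted tree `{0,1}*`. -/
def treeC : Equiv.Perm (List Bool) :=
  Function.Involutive.toPerm cFun (fun w => (bcFun_involutive w).2)

/-- The group `G = IMG(z²+i)`, the subgroup of `Perm({0,1}*)` generated by `a`, `b`, `c`. -/
def IMG : Subgroup (Equiv.Perm (List Bool)) := Subgroup.closure {treeA, treeB, treeC}

theorem treeA_mem_IMG : treeA ∈ IMG := Subgroup.subset_closure (by simp)
theorem treeB_mem_IMG : treeB ∈ IMG := Subgroup.subset_closure (by simp)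
theorem treeC_mem_IMG : treeC ∈ IMG := Subgroup.subset_closure (by simp)

/-- `a` as an element of the group `G`. -/
def gA : IMG := ⟨treeA, treeA_mem_IMG⟩
/-- `b` as an element of the group `G`. -/
def gB : IMG := ⟨treeB, treeB_mem_IMG⟩
/-- `c` as an element of the group `G`. -/
def gC : IMG := ⟨treeC, treeC_mem_IMG⟩

/-- The commutator `[x, y] = x⁻¹y⁻¹xy`. -/
def commElt {M : Type*} [Group M] (x y : M) : M := x⁻¹ * y⁻¹ * x * y

/-- The normal closure `N` in `G` of the commutators `[a,b]` and `[b,c]`. -/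
def NN : Subgroup IMG := Subgroup.normalClosure {commElt gA gB, commElt gB gC}

/-- A group generated by involutions `a`, `b`, `c` with `b` commuting with `a` and `c` and
`(a * c) ^ 4 = 1` is a quotient of `D₄ × C₂`. -/
theorem finite_and_card_le_sixteen_of_relations {Q : Type*} [Group Q] {a b c : Q}
    (ha : a * a = 1) (hb : b * b = 1) (hc : c * c = 1) (hab : Commute a b) (hbc : Commute b c)
    (hac : (a * c) ^ 4 = 1) (hgen : Subgroup.closure {a, b, c} = ⊤) :
    Finite Q ∧ Nat.card Q ≤ 16 := by
  have ha' : a⁻¹ = a := inv_eq_of_mul_eq_one_right ha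
  have hb' : b⁻¹ = b := inv_eq_of_mul_eq_one_right hb
  have hc' : c⁻¹ = c := inv_eq_of_mul_eq_one_right hc
  have hrinv : (a * c) ^ 3 = c * a := by
    have h : (a * c) ^ 3 = (a * c)⁻¹ := eq_inv_of_mul_eq_one_left (by rw [← pow_succ, hac])
    rw [h, mul_inv_rev, ha', hc']
  have mul_a : ∀ i j k : ℕ, a * ((a * c) ^ i * a ^ j * b ^ k) =
      (a * c) ^ (3 * i) * a ^ (j + 1) * b ^ k := by
    intro i j k
    have h : SemiconjBy a (a * c) (c * a) := by
      simp [SemiconjBy, ← mul_assoc, ha, mul_assoc c a a]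
    have hi := (h.pow_right i).eq
    rw [pow_mul, hrinv, pow_succ', ← mul_assoc, ← mul_assoc, hi]
    simp only [mul_assoc]
  have mul_b : ∀ i j k : ℕ, b * ((a * c) ^ i * a ^ j * b ^ k) =
      (a * c) ^ i * a ^ j * b ^ (k + 1) := by
    intro i j k
    have h : Commute b ((a * c) ^ i * a ^ j) :=
      ((hab.symm.mul_right hbc).pow_right i).mul_right (hab.symm.pow_right j)
    rw [← mul_assoc, h.eq, mul_assoc, pow_succ']
  have mul_c : ∀ i j k : ℕ, c * ((a * c) ^ i * a ^ j * b ^ k) =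
      (a * c) ^ (3 + 3 * i) * a ^ (j + 1) * b ^ k := by
    intro i j k
    have h : c = (a * c) ^ 3 * a := by rw [hrinv, mul_assoc, ha, mul_one]
    conv_lhs => arg 1; rw [h]
    rw [mul_assoc, mul_a, pow_add _ 3]
    simp only [mul_assoc]
  have normalForm : ∀ q : Q, ∃ i j k : ℕ, (a * c) ^ i * a ^ j * b ^ k = q := by
    intro q
    have hq : q ∈ Subgroup.closure {a, b, c} := hgen ▸ Subgroup.mem_top q
    induction hq using Subgroup.closure_induction_left with
    | one => exact ⟨0, 0, 0, by simp⟩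
    | mul_left x hx y _ ih =>
      obtain ⟨i, j, k, rfl⟩ := ih
      rcases hx with rfl | rfl | rfl
      · exact ⟨_, _, _, (mul_a i j k).symm⟩
      · exact ⟨_, _, _, (mul_b i j k).symm⟩
      · exact ⟨_, _, _, (mul_c i j k).symm⟩
    | inv_mul_cancel x hx y _ ih =>
      obtain ⟨i, j, k, rfl⟩ := ih
      rcases hx with rfl | rfl | rfl
      · exact ⟨_, _, _, by rw [ha', mul_a]⟩
      · exact ⟨_, _, _, by rw [hb', mul_b]⟩
      · exact ⟨_, _, _, by rw [hc', mul_c]⟩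
  let f : Fin 4 × Fin 2 × Fin 2 → Q := fun p =>
    (a * c) ^ (p.1 : ℕ) * a ^ (p.2.1 : ℕ) * b ^ (p.2.2 : ℕ)
  have hf : Function.Surjective f := by
    intro q
    obtain ⟨i, j, k, rfl⟩ := normalForm q
    refine ⟨(⟨i % 4, by lia⟩, ⟨j % 2, by lia⟩, ⟨k % 2, by lia⟩), ?_⟩
    rw [pow_eq_pow_mod i hac, pow_eq_pow_mod j ((sq a).trans ha),
      pow_eq_pow_mod k ((sq b).trans hb)]
  exact ⟨Finite.of_surjective f hf, by simpa using Nat.card_le_card_of_surjective f hf⟩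

theorem gA_mul_self : gA * gA = 1 :=
  Subtype.ext (Equiv.ext fun w => aFun_involutive w)

theorem gB_mul_self : gB * gB = 1 :=
  Subtype.ext (Equiv.ext fun w => (bcFun_involutive w).1)

theorem gC_mul_self : gC * gC = 1 :=
  Subtype.ext (Equiv.ext fun w => (bcFun_involutive w).2)

theorem gA_mul_gC_pow_four : (gA * gC) ^ 4 = 1 := by
  refine Subtype.ext (Equiv.ext fun w => ?_)
  change aFun (cFun (aFun (cFun (aFun (cFun (aFun (cFun w))))))) = w
  rcases w with _ | ⟨_ | _, w⟩ <;> simp [aFun, cFun, (bcFun_involutive _).1]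

theorem closure_gA_gB_gC : Subgroup.closure {gA, gB, gC} = (⊤ : Subgroup IMG) := by
  apply Subgroup.map_injective IMG.subtype_injective
  rw [MonoidHom.map_closure, ← MonoidHom.range_eq_map, Subgroup.range_subtype]
  rw [Set.image_insert_eq, Set.image_insert_eq, Set.image_singleton]
  rfl

instance NN_normal : NN.Normal := Subgroup.normalClosure_normal

theorem commute_mk_of_commElt_mem {M : Type*} [Group M] {N : Subgroup M} [N.Normal] {x y : M}
    (h : commElt x y ∈ N) : Commute (x : M ⧸ N) (y : M ⧸ N) := by
  have h' : (y * x)⁻¹ * (x * y) ∈ N := by simpa [commElt, mul_assoc] using h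
  exact (QuotientGroup.eq.mpr h').symm

/-- the normal subgroup `N` has finite index in `G`, at most 16. -/
theorem NN_finiteIndex_le_sixteen : NN.FiniteIndex ∧ NN.index ≤ 16 := by
  have hab : commElt gA gB ∈ NN := Subgroup.subset_normalClosure (by simp)
  have hbc : commElt gB gC ∈ NN := Subgroup.subset_normalClosure (by simp)
  have hgen : Subgroup.closure {(gA : IMG ⧸ NN), (gB : IMG ⧸ NN), (gC : IMG ⧸ NN)} = ⊤ := by
    have h := congrArg (Subgroup.map (QuotientGroup.mk' NN)) closure_gA_gB_gC
    rw [MonoidHom.map_closure,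
      Subgroup.map_top_of_surjective _ (QuotientGroup.mk'_surjective NN)] at h
    simpa [Set.image_insert_eq] using h
  obtain ⟨hfin, hcard⟩ := finite_and_card_le_sixteen_of_relations
    (congrArg (QuotientGroup.mk' NN) gA_mul_self) (congrArg (QuotientGroup.mk' NN) gB_mul_self)
    (congrArg (QuotientGroup.mk' NN) gC_mul_self) (commute_mk_of_commElt_mem hab)
    (commute_mk_of_commElt_mem hbc) (congrArg (QuotientGroup.mk' NN) gA_mul_gC_pow_four) hgen
  exact ⟨Subgroup.finiteIndex_of_finite_quotient, hcard⟩
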